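/- Let ω > 0, let M, N be integers with 1 < M < N, and let B : ℝ → ℂ be continuous. Then z = 0 is not a center for the binomial equation without linear term ż = z^N + B(t)z^M. -/

import Mathlib

/-- `z` is a solution of `ż = F(t,z)` on `[0, ω]`. -/
def IsSolution (ω : ℝ) (F : ℝ → ℂ → ℂ) (z : ℝ → ℂ) : Prop :=
  ∀ t ∈ Set.Icc (0 : ℝ) ω, HasDerivAt z (F t (z t)) t

/-- `z = 0` is a center for `ż = F(t,z)` with period `ω`. -/
def IsCenter (ω : ℝ) (F : ℝ → ℂ → ℂ) : Prop :=
  ∃ ε > (0 : ℝ), ∀ c : ℂ, ‖c‖ < ε →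
    ∃ z : ℝ → ℂ, IsSolution ω F z ∧ z 0 = c ∧ z ω = c


theorem aux_close (ω : ℝ) (hω : 0 < ω) (M N : ℕ) (hM : 1 < M) (hMN : M < N)
    (B : ℝ → ℂ) (K : ℝ) (hK0 : 0 ≤ K) (hK : ∀ t ∈ Set.Icc (0 : ℝ) ω, ‖B t‖ ≤ K)
    (η : ℝ) (hη : 0 < η) (hη1 : η < 1) (r : ℝ) (hr : 0 < r) (hr1 : 2 * r ≤ 1)
    (hr2 : (1 + K) * 4 * r * ω < η) (z : ℝ → ℂ)
    (hz : IsSolution ω (fun t z => z ^ N + B t * z ^ M) z) (h0 : z 0 = (r : ℂ)) :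
    ∀ t ∈ Set.Icc (0 : ℝ) ω, ‖z t - r‖ ≤ η * r := by
  have hb : ∀ t ∈ Set.Icc (0 : ℝ) ω, η * r / ω * t ≤ η * r := by
    intro t ht
    calc η * r / ω * t ≤ η * r / ω * ω := by
          apply mul_le_mul_of_nonneg_left ht.2; positivity
      _ = η * r := by field_simp
  have main : ∀ ⦃t⦄, t ∈ Set.Icc (0 : ℝ) ω → ‖z t - r‖ ≤ η * r / ω * t := by
    refine image_norm_le_of_norm_deriv_right_lt_deriv_boundary
      (f := fun t => z t - r) (f' := fun t => z t ^ N + B t * z t ^ M)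
      (B := fun t => η * r / ω * t) (B' := fun _ => η * r / ω) ?_ ?_ ?_ ?_ ?_
    · intro t ht
      exact ((hz t ht).continuousAt.continuousWithinAt).sub continuousWithinAt_const
    · intro t ht
      exact ((hz t ⟨ht.1, ht.2.le⟩).sub_const _).hasDerivWithinAt
    · simp [h0]
    · intro t
      simpa using (hasDerivAt_id t).const_mul (η * r / ω)
    · intro t ht heq
      have ht' : t ∈ Set.Icc (0 : ℝ) ω := ⟨ht.1, ht.2.le⟩
      have h1 := hb t ht'
      have h2 : ‖z t - r‖ ≤ η * r := heq.le.trans h1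
      have h3 : ‖z t‖ ≤ 2 * r := by
        have : ‖z t‖ ≤ ‖z t - r‖ + ‖(r : ℂ)‖ := by
          simpa using norm_add_le (z t - r) (r : ℂ)
        rw [Complex.norm_real, Real.norm_of_nonneg hr.le] at this
        nlinarith
      have h4 : ∀ m : ℕ, 2 ≤ m → ‖z t‖ ^ m ≤ 4 * r ^ 2 := by
        intro m hm
        calc ‖z t‖ ^ m ≤ ‖z t‖ ^ 2 :=
              pow_le_pow_of_le_one (norm_nonneg _) (h3.trans hr1) hm
          _ ≤ (2 * r) ^ 2 := by gcongr
          _ = 4 * r ^ 2 := by ring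
      have h5 := h4 N (by omega)
      have h6 := h4 M hM
      have h7 := hK t ht'
      calc ‖z t ^ N + B t * z t ^ M‖ ≤ ‖z t ^ N‖ + ‖B t * z t ^ M‖ := norm_add_le _ _
        _ = ‖z t‖ ^ N + ‖B t‖ * ‖z t‖ ^ M := by simp
        _ ≤ 4 * r ^ 2 + K * (4 * r ^ 2) := by gcongr
        _ < η * r / ω := by
          rw [lt_div_iff₀ hω]
          nlinarith
  intro t ht
  exact (main ht).trans (hb t ht)

theorem aux_int (ω : ℝ) (hω : 0 < ω) (M N : ℕ) (hM : 1 < M) (hMN : M < N)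
    (B : ℝ → ℂ) (hB : Continuous B) (z : ℝ → ℂ)
    (hz : IsSolution ω (fun t z => z ^ N + B t * z ^ M) z)
    (hne : ∀ t ∈ Set.Icc (0 : ℝ) ω, z t ≠ 0) (h : z ω = z 0) :
    (∫ t in (0 : ℝ)..ω, z t ^ (N - M)) + ∫ t in (0 : ℝ)..ω, B t = 0 := by
  have hu : Set.uIcc 0 ω = Set.Icc 0 ω := Set.uIcc_of_le hω.le
  have hzc : ContinuousOn z (Set.uIcc 0 ω) := by
    intro t ht
    rw [hu] at ht
    exact (hz t ht).continuousAt.continuousWithinAt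
  have hi : IntervalIntegrable (fun t => z t ^ (N - M)) MeasureTheory.volume 0 ω :=
    (hzc.pow _).intervalIntegrable
  have hiB : IntervalIntegrable B MeasureTheory.volume 0 ω := hB.intervalIntegrable _ _
  rw [← intervalIntegral.integral_add hi hiB]
  obtain ⟨m, rfl⟩ : ∃ m, M = m + 2 := ⟨M - 2, by omega⟩
  obtain ⟨k, rfl⟩ : ∃ k, N = m + 2 + k := ⟨N - (m + 2), by omega⟩
  have hd : ∀ t ∈ Set.uIcc 0 ω, HasDerivAt (fun t => (z t ^ (m + 1))⁻¹)
      (-((m : ℂ) + 1) * (z t ^ (m + 2 + k - (m + 2)) + B t)) t := by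
    intro t ht
    rw [hu] at ht
    have hn := hne t ht
    have h2 : HasDerivAt (fun t => (z t ^ (m + 1))⁻¹) _ t :=
      ((hz t ht).pow (m + 1)).inv (pow_ne_zero _ hn)
    refine h2.congr_deriv ?_
    simp only [Nat.add_sub_cancel_left, Nat.add_sub_cancel, Pi.pow_apply]
    push_cast
    field_simp
    ring
  have := intervalIntegral.integral_eq_sub_of_hasDerivAt hd ((hi.add hiB).const_mul _)
  rw [intervalIntegral.integral_const_mul, h, sub_self] at this
  rcases mul_eq_zero.1 this with h1 | h1
  · exfalso
    rw [neg_eq_zero] at h1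
    exact Nat.cast_add_one_ne_zero m h1
  · exact h1

theorem stmt_9 (ω : ℝ) (hω : 0 < ω)
    (M N : ℕ) (hM : 1 < M) (hMN : M < N)
    (B : ℝ → ℂ) (hB : Continuous B) :
    ¬ IsCenter ω (fun t z => z ^ N + B t * z ^ M) := by
  rintro ⟨ε, hε, hc⟩
  obtain ⟨K, hK⟩ := (isCompact_Icc (a := (0 : ℝ)) (b := ω)).exists_bound_of_continuousOn
    hB.continuousOn
  have hK0 : 0 ≤ K := (norm_nonneg _).trans (hK 0 ⟨le_rfl, hω.le⟩)
  set k := N - M with hk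
  obtain ⟨η₀, hη₀, hη⟩ := Metric.continuousAt_iff.1
    ((continuous_pow k).continuousAt (x := (1 : ℂ))) (1 / 4) (by norm_num)
  set η := min (η₀ / 2) (1 / 2) with hηd
  have hηp : 0 < η := by positivity
  have hη1 : η < 1 := (min_le_right _ _).trans_lt (by norm_num)
  have hη2 : η < η₀ := (min_le_left _ _).trans_lt (by linarith)
  set r₀ := min (ε / 2) (min (1 / 2) (η / (2 * ((1 + K) * 4 * ω)))) with hr₀
  have hr₀p : 0 < r₀ := by positivity
  have key : ∀ r : ℝ, 0 < r → r ≤ r₀ →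
      ‖(∫ t in (0 : ℝ)..ω, B t) + ω * (r : ℂ) ^ k‖ ≤ ω * r ^ k / 4 := by
    intro r hr hrr
    have a1 : r < ε := by
      have := hrr.trans (min_le_left _ _)
      linarith
    have a2 : 2 * r ≤ 1 := by
      have := hrr.trans ((min_le_right _ _).trans (min_le_left _ _))
      linarith
    have a3 : (1 + K) * 4 * r * ω < η := by
      have := hrr.trans ((min_le_right _ _).trans (min_le_right _ _))
      rw [le_div_iff₀ (by positivity)] at this
      nlinarith
    obtain ⟨z, hz, h0, h1⟩ := hc r (by
      rwa [Complex.norm_real, Real.norm_of_nonneg hr.le])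
    have hcl := aux_close ω hω M N hM hMN B K hK0 hK η hηp hη1 r hr a2 a3 z hz h0
    have hrc : (r : ℂ) ≠ 0 := by exact_mod_cast hr.ne'
    have hne : ∀ t ∈ Set.Icc (0 : ℝ) ω, z t ≠ 0 := by
      intro t ht h
      have := hcl t ht
      rw [h, zero_sub, norm_neg, Complex.norm_real, Real.norm_of_nonneg hr.le] at this
      nlinarith
    have hint := aux_int ω hω M N hM hMN B hB z hz hne (h1.trans h0.symm)
    rw [← hk] at hint
    have hpt : ∀ t ∈ Set.Icc (0 : ℝ) ω, ‖(r : ℂ) ^ k - z t ^ k‖ ≤ r ^ k / 4 := by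
      intro t ht
      have b1 : dist (z t / r) 1 < η₀ := by
        rw [dist_eq_norm, div_sub_one hrc, norm_div, Complex.norm_real,
          Real.norm_of_nonneg hr.le, div_lt_iff₀ hr]
        exact (hcl t ht).trans_lt (by gcongr)
      have b2 := hη b1
      rw [dist_eq_norm, one_pow, div_pow, div_sub_one (pow_ne_zero _ hrc), norm_div, norm_pow,
        Complex.norm_real, Real.norm_of_nonneg hr.le, div_lt_iff₀ (by positivity)] at b2
      rw [norm_sub_rev]
      linarith
    have hzc : ContinuousOn z (Set.uIcc 0 ω) := by
      intro t ht
      rw [Set.uIcc_of_le hω.le] at ht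
      exact (hz t ht).continuousAt.continuousWithinAt
    have e : (∫ t in (0 : ℝ)..ω, B t) + ω * (r : ℂ) ^ k
        = ∫ t in (0 : ℝ)..ω, ((r : ℂ) ^ k - z t ^ k) := by
      have i2 : IntervalIntegrable (fun t => z t ^ k) MeasureTheory.volume 0 ω :=
        (hzc.pow _).intervalIntegrable
      have i1 : IntervalIntegrable (fun _ : ℝ => (r : ℂ) ^ k) MeasureTheory.volume 0 ω :=
        continuous_const.intervalIntegrable _ _
      rw [intervalIntegral.integral_sub i1 i2, intervalIntegral.integral_const]
      simp only [sub_zero, Complex.real_smul]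
      linear_combination hint
    rw [e]
    have := intervalIntegral.norm_integral_le_of_norm_le_const (a := (0 : ℝ)) (b := ω)
      (f := fun t => (r : ℂ) ^ k - z t ^ k) (C := r ^ k / 4) (by
        intro t ht
        rw [Set.uIoc_of_le hω.le] at ht
        exact hpt t ⟨ht.1.le, ht.2⟩)
    rw [sub_zero, abs_of_pos hω] at this
    linarith
  have k1 := key r₀ hr₀p le_rfl
  have k2 := key (r₀ / 2) (by positivity) (by linarith)
  have hhalf : (r₀ / 2) ^ k ≤ r₀ ^ k / 2 := by
    rw [div_pow]
    have : (2 : ℝ) ≤ 2 ^ k := by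
      simpa using pow_le_pow_right₀ (one_le_two : (1 : ℝ) ≤ 2) (show 1 ≤ k by omega)
    gcongr
  have hp : 0 < ω * r₀ ^ k := by positivity
  have hh : ω * (r₀ / 2) ^ k ≤ ω * r₀ ^ k / 2 := by
    calc _ ≤ ω * (r₀ ^ k / 2) := by gcongr
      _ = _ := by ring
  have k3 := norm_sub_le ((∫ t in (0 : ℝ)..ω, B t) + ω * (r₀ : ℂ) ^ k)
    ((∫ t in (0 : ℝ)..ω, B t) + ω * ((r₀ / 2 : ℝ) : ℂ) ^ k)
  have e2 : ((∫ t in (0 : ℝ)..ω, B t) + ω * (r₀ : ℂ) ^ k) -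
    ((∫ t in (0 : ℝ)..ω, B t) + ω * ((r₀ / 2 : ℝ) : ℂ) ^ k)
      = ((ω * r₀ ^ k - ω * (r₀ / 2) ^ k : ℝ) : ℂ) := by
    push_cast; ring
  rw [e2, Complex.norm_real] at k3
  have k4 := Real.le_norm_self (ω * r₀ ^ k - ω * (r₀ / 2) ^ k)
  linarith
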